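/- Preservation of reduction under the translation into IL⊥: define the translation (·)* from proof terms of CD to proof terms of IL⊥ that leaves types unchanged, replaces each constant D^I (for an instance I = ∀α(A∨B) → ∀α A ∨ B of the constant domain axiom) by the term λf. f c [z. ι0(λα. f α [x. x, y. d^A]), z. ι1(z)], and commutes with all other term formers. Then for all proof terms v, w of CD, if v ↦ w then v* ↦⁺ w*, where ↦⁺ is the transitive closure of the one-step reduction relation of IL⊥. -/

import Mathlib

/-! A Curry-Howard formalization of the intuitionistic first-order logic of
constant domains CD (Aschieri-Genco style), with de Bruijn indices both for
first-order variables and for proof-term variables. -/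

/-- First-order terms: variables (de Bruijn), constants, function applications. -/
inductive Tm : Type where
  | var : ℕ → Tm
  | const : ℕ → Tm
  | func : ℕ → List Tm → Tm

namespace Tm

/-- Lift (shift by `d`) the first-order variables `≥ c`. -/
def lift (d c : ℕ) : Tm → Tm
  | var i => if i < c then var i else var (i + d)
  | const k => const k
  | func f ts => func f (ts.attach.map fun x => lift d c x.1)
termination_by t => sizeOf t
decreasing_by have := List.sizeOf_lt_of_mem x.2; simp; omega

/-- Substitute the term `m` for the first-order variable `k` (variables `> k` are decremented). -/
def subst (k : ℕ) (m : Tm) : Tm → Tm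
  | var i => if i = k then m else if i < k then var i else var (i - 1)
  | const c' => const c'
  | func f ts => func f (ts.attach.map fun x => subst k m x.1)
termination_by t => sizeOf t
decreasing_by have := List.sizeOf_lt_of_mem x.2; simp; omega

end Tm

/-- First-order formulas, with de Bruijn quantifiers. -/
inductive Fml : Type where
  | atom : ℕ → List Tm → Fml
  | bot : Fml
  | conj : Fml → Fml → Fml
  | disj : Fml → Fml → Fml
  | impl : Fml → Fml → Fml
  | all : Fml → Fml
  | ex : Fml → Fml

namespace Fml

/-- Lift (shift by `d`) the free first-order variables `≥ c`. -/
def lift (d : ℕ) : ℕ → Fml → Fml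
  | c, atom P ts => atom P (ts.map (Tm.lift d c))
  | _, bot => bot
  | c, conj A B => conj (lift d c A) (lift d c B)
  | c, disj A B => disj (lift d c A) (lift d c B)
  | c, impl A B => impl (lift d c A) (lift d c B)
  | c, all A => all (lift d (c + 1) A)
  | c, ex A => ex (lift d (c + 1) A)

/-- Substitute the term `m` for the free first-order variable `k`. -/
def subst : ℕ → Tm → Fml → Fml
  | k, m, atom P ts => atom P (ts.map (Tm.subst k m))
  | _, _, bot => bot
  | k, m, conj A B => conj (subst k m A) (subst k m B)
  | k, m, disj A B => disj (subst k m A) (subst k m B)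
  | k, m, impl A B => impl (subst k m A) (subst k m B)
  | k, m, all A => all (subst (k + 1) (m.lift 1 0) A)
  | k, m, ex A => ex (subst (k + 1) (m.lift 1 0) A)

/-- Atomic formulas (including `⊥`, a 0-ary predicate symbol). -/
def Atomic : Fml → Prop
  | atom _ _ => True
  | bot => True
  | _ => False

end Fml

/-- Proof terms of CD. Proof-term variables are de Bruijn indices; `lam`
binds a proof variable, `qlam` binds a first-order variable, `case` binds one
proof variable in each branch, `edest` binds one first-order variable and one
proof variable in its second argument. `D A B` is the constant for the
constant-domain axiom `∀α(A ∨ B) → ∀α A ∨ B` (in de Bruijn style, `A` may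
contain the bound variable `0` while `B` is a formula of the outer context,
so that "`α` does not occur in `B`" holds by construction). -/
inductive Pf : Type where
  | var : ℕ → Pf
  | pair : Pf → Pf → Pf
  | proj : Bool → Pf → Pf
  | lam : Fml → Pf → Pf
  | app : Pf → Pf → Pf
  | inj : Bool → Pf → Pf
  | case : Pf → Pf → Pf → Pf
  | qlam : Pf → Pf
  | qapp : Pf → Tm → Pf
  | epair : Tm → Pf → Pf
  | edest : Pf → Pf → Pf
  | efq : Fml → Pf → Pf
  | D : Fml → Fml → Pf
  | F : Pf

namespace Pf

/-- Lift the free first-order variables `≥ c` by `d` in a proof term. -/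
def tlift : Pf → ℕ → ℕ → Pf
  | var n, _, _ => var n
  | pair u t, d, c => pair (tlift u d c) (tlift t d c)
  | proj b u, d, c => proj b (tlift u d c)
  | lam A u, d, c => lam (A.lift d c) (tlift u d c)
  | app u t, d, c => app (tlift u d c) (tlift t d c)
  | inj b u, d, c => inj b (tlift u d c)
  | case u w₁ w₂, d, c => case (tlift u d c) (tlift w₁ d c) (tlift w₂ d c)
  | qlam u, d, c => qlam (tlift u d (c + 1))
  | qapp u m, d, c => qapp (tlift u d c) (m.lift d c)
  | epair m u, d, c => epair (m.lift d c) (tlift u d c)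
  | edest u v, d, c => edest (tlift u d c) (tlift v d (c + 1))
  | efq P u, d, c => efq (P.lift d c) (tlift u d c)
  | D A B, d, c => D (A.lift d (c + 1)) (B.lift d c)
  | F, _, _ => F

/-- Lift the free proof-term variables `≥ c` by `d` in a proof term. -/
def plift : Pf → ℕ → ℕ → Pf
  | var n, d, c => if n < c then var n else var (n + d)
  | pair u t, d, c => pair (plift u d c) (plift t d c)
  | proj b u, d, c => proj b (plift u d c)
  | lam A u, d, c => lam A (plift u d (c + 1))
  | app u t, d, c => app (plift u d c) (plift t d c)
  | inj b u, d, c => inj b (plift u d c)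
  | case u w₁ w₂, d, c => case (plift u d c) (plift w₁ d (c + 1)) (plift w₂ d (c + 1))
  | qlam u, d, c => qlam (plift u d c)
  | qapp u m, d, c => qapp (plift u d c) m
  | epair m u, d, c => epair m (plift u d c)
  | edest u v, d, c => edest (plift u d c) (plift v d (c + 1))
  | efq P u, d, c => efq P (plift u d c)
  | D A B, _, _ => D A B
  | F, _, _ => F

/-- Substitute the proof term `q` for the proof variable `k` (variables `> k` decremented). -/
def psubst : Pf → ℕ → Pf → Pf
  | var n, k, q => if n = k then q else if n < k then var n else var (n - 1)
  | pair u t, k, q => pair (psubst u k q) (psubst t k q)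
  | proj b u, k, q => proj b (psubst u k q)
  | lam A u, k, q => lam A (psubst u (k + 1) (plift q 1 0))
  | app u t, k, q => app (psubst u k q) (psubst t k q)
  | inj b u, k, q => inj b (psubst u k q)
  | case u w₁ w₂, k, q =>
      case (psubst u k q) (psubst w₁ (k + 1) (plift q 1 0)) (psubst w₂ (k + 1) (plift q 1 0))
  | qlam u, k, q => qlam (psubst u k (tlift q 1 0))
  | qapp u m, k, q => qapp (psubst u k q) m
  | epair m u, k, q => epair m (psubst u k q)
  | edest u v, k, q => edest (psubst u k q) (psubst v (k + 1) (tlift (plift q 1 0) 1 0))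
  | efq P u, k, q => efq P (psubst u k q)
  | D A B, _, _ => D A B
  | F, _, _ => F

/-- Substitute the first-order term `m` for the first-order variable `k` in a proof term. -/
def tsubst : Pf → ℕ → Tm → Pf
  | var n, _, _ => var n
  | pair u t, k, m => pair (tsubst u k m) (tsubst t k m)
  | proj b u, k, m => proj b (tsubst u k m)
  | lam A u, k, m => lam (A.subst k m) (tsubst u k m)
  | app u t, k, m => app (tsubst u k m) (tsubst t k m)
  | inj b u, k, m => inj b (tsubst u k m)
  | case u w₁ w₂, k, m => case (tsubst u k m) (tsubst w₁ k m) (tsubst w₂ k m)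
  | qlam u, k, m => qlam (tsubst u (k + 1) (m.lift 1 0))
  | qapp u t, k, m => qapp (tsubst u k m) (Tm.subst k m t)
  | epair t u, k, m => epair (Tm.subst k m t) (tsubst u k m)
  | edest u v, k, m => edest (tsubst u k m) (tsubst v (k + 1) (m.lift 1 0))
  | efq P u, k, m => efq (P.subst k m) (tsubst u k m)
  | D A B, k, m => D (A.subst (k + 1) (m.lift 1 0)) (B.subst k m)
  | F, _, _ => F

/-- The set of free proof-term variables of a proof term. -/
def fvars : Pf → Set ℕ
  | var n => {n}
  | pair u t => fvars u ∪ fvars t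
  | proj _ u => fvars u
  | lam _ u => {n | n + 1 ∈ fvars u}
  | app u t => fvars u ∪ fvars t
  | inj _ u => fvars u
  | case u w₁ w₂ => fvars u ∪ {n | n + 1 ∈ fvars w₁} ∪ {n | n + 1 ∈ fvars w₂}
  | qlam u => fvars u
  | qapp u _ => fvars u
  | epair _ u => fvars u
  | edest u v => fvars u ∪ {n | n + 1 ∈ fvars v}
  | efq _ u => fvars u
  | D _ _ => ∅
  | F => ∅

end Pf

/-- The one-step reduction relation of CD: intuitionistic redexes, the two
redexes for the constant-domain constants `D` (with fixed constant
`c = Tm.const 0`), and closure under every term context. -/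
inductive StepCD : Pf → Pf → Prop where
  | beta {A u t} : StepCD (.app (.lam A u) t) (u.psubst 0 t)
  | qbeta {u m} : StepCD (.qapp (.qlam u) m) (u.tsubst 0 m)
  | projPair {u₀ u₁ b} : StepCD (.proj b (.pair u₀ u₁)) (if b then u₁ else u₀)
  | caseInj {b u w₁ w₂} : StepCD (.case (.inj b u) w₁ w₂) ((if b then w₂ else w₁).psubst 0 u)
  | edestPair {m u v} : StepCD (.edest (.epair m u) v) ((v.tsubst 0 m).psubst 0 u)
  | DinjL {A B u} : StepCD (.app (.D A B) (.qlam (.inj false u))) (.inj false (.qlam u))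
  | DinjR {A B u} :
      StepCD (.app (.D A B) (.qlam (.inj true u))) (.inj true (u.tsubst 0 (.const 0)))
  | pairL {u u' t} : StepCD u u' → StepCD (.pair u t) (.pair u' t)
  | pairR {u t t'} : StepCD t t' → StepCD (.pair u t) (.pair u t')
  | projC {b u u'} : StepCD u u' → StepCD (.proj b u) (.proj b u')
  | lamC {A u u'} : StepCD u u' → StepCD (.lam A u) (.lam A u')
  | appL {u u' t} : StepCD u u' → StepCD (.app u t) (.app u' t)
  | appR {u t t'} : StepCD t t' → StepCD (.app u t) (.app u t')
  | injC {b u u'} : StepCD u u' → StepCD (.inj b u) (.inj b u')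
  | caseU {u u' w₁ w₂} : StepCD u u' → StepCD (.case u w₁ w₂) (.case u' w₁ w₂)
  | caseL {u w₁ w₁' w₂} : StepCD w₁ w₁' → StepCD (.case u w₁ w₂) (.case u w₁' w₂)
  | caseR {u w₁ w₂ w₂'} : StepCD w₂ w₂' → StepCD (.case u w₁ w₂) (.case u w₁ w₂')
  | qlamC {u u'} : StepCD u u' → StepCD (.qlam u) (.qlam u')
  | qappC {u u' m} : StepCD u u' → StepCD (.qapp u m) (.qapp u' m)
  | epairC {m u u'} : StepCD u u' → StepCD (.epair m u) (.epair m u')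
  | edestL {u u' v} : StepCD u u' → StepCD (.edest u v) (.edest u' v)
  | edestR {u v v'} : StepCD v v' → StepCD (.edest u v) (.edest u v')
  | efqC {P u u'} : StepCD u u' → StepCD (.efq P u) (.efq P u')

/-- The one-step reduction relation of IL⊥: only the standard intuitionistic
redexes, closed under every term context. -/
inductive StepIL : Pf → Pf → Prop where
  | beta {A u t} : StepIL (.app (.lam A u) t) (u.psubst 0 t)
  | qbeta {u m} : StepIL (.qapp (.qlam u) m) (u.tsubst 0 m)
  | projPair {u₀ u₁ b} : StepIL (.proj b (.pair u₀ u₁)) (if b then u₁ else u₀)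
  | caseInj {b u w₁ w₂} : StepIL (.case (.inj b u) w₁ w₂) ((if b then w₂ else w₁).psubst 0 u)
  | edestPair {m u v} : StepIL (.edest (.epair m u) v) ((v.tsubst 0 m).psubst 0 u)
  | pairL {u u' t} : StepIL u u' → StepIL (.pair u t) (.pair u' t)
  | pairR {u t t'} : StepIL t t' → StepIL (.pair u t) (.pair u t')
  | projC {b u u'} : StepIL u u' → StepIL (.proj b u) (.proj b u')
  | lamC {A u u'} : StepIL u u' → StepIL (.lam A u) (.lam A u')
  | appL {u u' t} : StepIL u u' → StepIL (.app u t) (.app u' t)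
  | appR {u t t'} : StepIL t t' → StepIL (.app u t) (.app u t')
  | injC {b u u'} : StepIL u u' → StepIL (.inj b u) (.inj b u')
  | caseU {u u' w₁ w₂} : StepIL u u' → StepIL (.case u w₁ w₂) (.case u' w₁ w₂)
  | caseL {u w₁ w₁' w₂} : StepIL w₁ w₁' → StepIL (.case u w₁ w₂) (.case u w₁' w₂)
  | caseR {u w₁ w₂ w₂'} : StepIL w₂ w₂' → StepIL (.case u w₁ w₂) (.case u w₁ w₂')
  | qlamC {u u'} : StepIL u u' → StepIL (.qlam u) (.qlam u')
  | qappC {u u' m} : StepIL u u' → StepIL (.qapp u m) (.qapp u' m)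
  | epairC {m u u'} : StepIL u u' → StepIL (.epair m u) (.epair m u')
  | edestL {u u' v} : StepIL u u' → StepIL (.edest u v) (.edest u' v)
  | edestR {u v v'} : StepIL v v' → StepIL (.edest u v) (.edest u v')
  | efqC {P u u'} : StepIL u u' → StepIL (.efq P u) (.efq P u')

/-- `v` is a proof term of CD when it does not contain the IL⊥ constant `F`. -/
def Pf.IsCD : Pf → Prop
  | .var _ => True
  | .pair u t => u.IsCD ∧ t.IsCD
  | .proj _ u => u.IsCD
  | .lam _ u => u.IsCD
  | .app u t => u.IsCD ∧ t.IsCD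
  | .inj _ u => u.IsCD
  | .case u w₁ w₂ => u.IsCD ∧ w₁.IsCD ∧ w₂.IsCD
  | .qlam u => u.IsCD
  | .qapp u _ => u.IsCD
  | .epair _ u => u.IsCD
  | .edest u v => u.IsCD ∧ v.IsCD
  | .efq _ u => u.IsCD
  | .D _ _ => True
  | .F => False

/-- Size of a formula, counting connectives only (first-order terms do not
contribute), so that it is invariant under first-order substitution. -/
def Fml.csize : Fml → ℕ
  | .atom _ _ => 1
  | .bot => 1
  | .conj A B => A.csize + B.csize + 1
  | .disj A B => A.csize + B.csize + 1
  | .impl A B => A.csize + B.csize + 1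
  | .all A => A.csize + 1
  | .ex A => A.csize + 1

theorem Fml.csize_subst (A : Fml) : ∀ (k : ℕ) (m : Tm), (A.subst k m).csize = A.csize := by
  induction A <;> intro k m <;> simp [Fml.subst, Fml.csize, *]

/-- The dummy closed proof term `d^A : A` of IL⊥, obtained from the constant
`F : ⊥` by ex falso (following the structure of `A`). -/
def dummy : Fml → Pf
  | .atom P ts => .efq (.atom P ts) .F
  | .bot => .F
  | .conj A B => .pair (dummy A) (dummy B)
  | .disj A B => .inj false (dummy A)
  | .impl A B => .lam A (dummy B)
  | .all A => .qlam (dummy A)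
  | .ex A => .epair (.const 0) (dummy (A.subst 0 (.const 0)))
termination_by A => A.csize
decreasing_by all_goals simp [Fml.csize, Fml.csize_subst] <;> omega

/-- The translation of the constant `D^I` for the instance
`I = ∀α(A ∨ B) → ∀α A ∨ B`:
`(D^I)* = λf. f c [z. ι₀(λα. f α [x. x, y. d^A]), z. ι₁(z)]`. -/
def transD (A B : Fml) : Pf :=
  .lam (.all (.disj A (B.lift 1 0)))
    (.case (.qapp (.var 0) (Tm.const 0))
      (.inj false (.qlam (.case (.qapp (.var 1) (Tm.var 0)) (.var 0) (dummy A))))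
      (.inj true (.var 0)))

/-- The translation `(·)* : CD → IL⊥`: it replaces every constant `D^I` by
`(D^I)*` and commutes with all other term formers. -/
def transPf : Pf → Pf
  | .var n => .var n
  | .pair u t => .pair (transPf u) (transPf t)
  | .proj b u => .proj b (transPf u)
  | .lam A u => .lam A (transPf u)
  | .app u t => .app (transPf u) (transPf t)
  | .inj b u => .inj b (transPf u)
  | .case u w₁ w₂ => .case (transPf u) (transPf w₁) (transPf w₂)
  | .qlam u => .qlam (transPf u)
  | .qapp u m => .qapp (transPf u) m
  | .epair m u => .epair m (transPf u)
  | .edest u v => .edest (transPf u) (transPf v)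
  | .efq P u => .efq P (transPf u)
  | .D A B => transD A B
  | .F => .F

namespace Tm

/-- Structural induction on first-order terms, with hypotheses for all arguments of a function. -/
theorem induction_args {P : Tm → Prop} (var : ∀ i, P (.var i)) (const : ∀ c, P (.const c))
    (func : ∀ f ts, (∀ t ∈ ts, P t) → P (.func f ts)) (t : Tm) : P t :=
  Tm.rec (motive_1 := P) (motive_2 := fun ts => ∀ t ∈ ts, P t) var const func
    (by simp) (fun _ _ h hs => by simpa using ⟨h, hs⟩) t

@[simp] theorem lift_const (d c k : ℕ) : (const k).lift d c = const k := by rw [lift]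

@[simp] theorem subst_const (k : ℕ) (m : Tm) (c : ℕ) : subst k m (const c) = const c := by
  rw [subst]

theorem lift_var (d c i : ℕ) : (var i).lift d c = if i < c then var i else var (i + d) := by
  rw [lift]

theorem subst_var (k : ℕ) (m : Tm) (i : ℕ) :
    subst k m (var i) = if i = k then m else if i < k then var i else var (i - 1) := by
  rw [subst]

@[simp] theorem lift_func (d c f : ℕ) (ts : List Tm) :
    (func f ts).lift d c = func f (ts.map (lift d c)) := by
  rw [lift]; simp

@[simp] theorem subst_func (k : ℕ) (m : Tm) (f : ℕ) (ts : List Tm) :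
    subst k m (func f ts) = func f (ts.map (subst k m)) := by
  rw [subst]; simp

theorem lift_lift (t : Tm) {b c : ℕ} (d e : ℕ) (h : b ≤ c) :
    (t.lift e b).lift d (c + e) = (t.lift d c).lift e b := by
  induction t using induction_args with
  | var i => grind [lift_var]
  | const => simp
  | func f ts ih => simpa using ih

theorem subst_lift_cancel (t : Tm) (k : ℕ) (m : Tm) : subst k m (t.lift 1 k) = t := by
  induction t using induction_args with
  | var i => grind [lift_var, subst_var]
  | const => simp
  | func f ts ih => simpa [Function.comp_def] using (List.map_congr_left (g := id) ih).trans ts.map_id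

theorem subst_var_lift (t : Tm) (k : ℕ) : subst k (var k) (t.lift 1 (k + 1)) = t := by
  induction t using induction_args with
  | var i => grind [lift_var, subst_var]
  | const => simp
  | func f ts ih => simpa [Function.comp_def] using (List.map_congr_left (g := id) ih).trans ts.map_id

theorem lift_subst (t : Tm) {b k : ℕ} (m : Tm) (h : b ≤ k) :
    subst (k + 1) (m.lift 1 b) (t.lift 1 b) = (subst k m t).lift 1 b := by
  induction t using induction_args with
  | var i => grind [lift_var, subst_var]
  | const => simp
  | func f ts ih => simpa using ih

theorem subst_lift (t : Tm) {k c : ℕ} (d : ℕ) (m : Tm) (h : k ≤ c) :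
    subst k (m.lift d c) (t.lift d (c + 1)) = (subst k m t).lift d c := by
  induction t using induction_args with
  | var i => grind [lift_var, subst_var]
  | const => simp
  | func f ts ih => simpa using ih

theorem subst_subst (t : Tm) {j k : ℕ} (p m : Tm) (h : j ≤ k) :
    subst j (subst k m p) (subst (k + 1) (m.lift 1 j) t) = subst k m (subst j p t) := by
  induction t using induction_args with
  | var i => grind [subst_var, subst_lift_cancel]
  | const => simp
  | func f ts ih => simpa using ih

end Tm

namespace Fml

theorem lift_lift (A : Fml) (d e : ℕ) : ∀ {b c : ℕ}, b ≤ c →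
    (A.lift e b).lift d (c + e) = (A.lift d c).lift e b := by
  induction A <;> intro b c h <;>
    simp_all [lift, Tm.lift_lift, Nat.add_right_comm _ e 1]

theorem subst_var_lift (A : Fml) : ∀ k : ℕ, (A.lift 1 (k + 1)).subst k (.var k) = A := by
  induction A <;> intro k <;>
    simp_all [lift, subst, Tm.subst_var_lift, Tm.lift_var, Function.comp_def]

theorem lift_subst (A : Fml) : ∀ {b k : ℕ} (m : Tm), b ≤ k →
    (A.lift 1 b).subst (k + 1) (m.lift 1 b) = (A.subst k m).lift 1 b := by
  induction A <;> intro b k m h <;>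
    simp_all [lift, subst, Tm.lift_subst, ← Tm.lift_lift]

theorem subst_lift (A : Fml) (d : ℕ) : ∀ {k c : ℕ} (m : Tm), k ≤ c →
    (A.lift d (c + 1)).subst k (m.lift d c) = (A.subst k m).lift d c := by
  induction A <;> intro k c m h <;>
    simp_all [lift, subst, Tm.subst_lift, ← Tm.lift_lift]

theorem subst_subst (A : Fml) : ∀ {j k : ℕ} (p m : Tm), j ≤ k →
    (A.subst (k + 1) (m.lift 1 j)).subst j (Tm.subst k m p) = (A.subst j p).subst k m := by
  induction A <;> intro j k p m h <;>
    simp_all [subst, Tm.subst_subst, ← Tm.lift_lift, ← Tm.lift_subst]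

end Fml

theorem plift_dummy (A : Fml) (d c : ℕ) : (dummy A).plift d c = dummy A := by
  induction A using dummy.induct generalizing c <;> simp_all [dummy, Pf.plift]

theorem psubst_dummy (A : Fml) (k : ℕ) (q : Pf) : (dummy A).psubst k q = dummy A := by
  induction A using dummy.induct generalizing k q <;> simp_all [dummy, Pf.psubst]

theorem tlift_dummy (A : Fml) (d c : ℕ) : (dummy A).tlift d c = dummy (A.lift d c) := by
  induction A using dummy.induct generalizing c <;>
    simp_all [dummy, Pf.tlift, Fml.lift, ← Fml.subst_lift]

theorem tsubst_dummy (A : Fml) (k : ℕ) (m : Tm) :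
    (dummy A).tsubst k m = dummy (A.subst k m) := by
  induction A using dummy.induct generalizing k m <;>
    simp_all [dummy, Pf.tsubst, Fml.subst, ← Fml.subst_subst]

theorem plift_transD (A B : Fml) (d c : ℕ) : (transD A B).plift d c = transD A B := by
  simp [transD, Pf.plift, plift_dummy]

theorem psubst_transD (A B : Fml) (k : ℕ) (q : Pf) : (transD A B).psubst k q = transD A B := by
  simp [transD, Pf.psubst, psubst_dummy]

theorem tlift_transD (A B : Fml) (d c : ℕ) :
    (transD A B).tlift d c = transD (A.lift d (c + 1)) (B.lift d c) := by
  simp [transD, Pf.tlift, tlift_dummy, Fml.lift, Tm.lift_var, Fml.lift_lift]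

theorem tsubst_transD (A B : Fml) (k : ℕ) (m : Tm) :
    (transD A B).tsubst k m = transD (A.subst (k + 1) (m.lift 1 0)) (B.subst k m) := by
  simp [transD, Pf.tsubst, tsubst_dummy, Fml.subst, Tm.subst_var, Fml.lift_subst]

theorem transPf_plift (u : Pf) (d : ℕ) : ∀ c, transPf (u.plift d c) = (transPf u).plift d c := by
  induction u <;> intro c <;> simp_all [transPf, Pf.plift, plift_transD]
  split <;> rfl

theorem transPf_tlift (u : Pf) (d : ℕ) : ∀ c, transPf (u.tlift d c) = (transPf u).tlift d c := by
  induction u <;> intro c <;> simp_all [transPf, Pf.tlift, tlift_transD]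

theorem transPf_psubst (u : Pf) : ∀ k q,
    transPf (u.psubst k q) = (transPf u).psubst k (transPf q) := by
  induction u <;> intro k q <;>
    simp_all [transPf, Pf.psubst, psubst_transD, transPf_plift, transPf_tlift]
  grind [transPf]

theorem transPf_tsubst (u : Pf) : ∀ k m,
    transPf (u.tsubst k m) = (transPf u).tsubst k m := by
  induction u <;> intro k m <;> simp_all [transPf, Pf.tsubst, tsubst_transD]

namespace Pf

theorem tlift_plift (u : Pf) (d e : ℕ) : ∀ b c,
    (u.plift d b).tlift e c = (u.tlift e c).plift d b := by
  induction u <;> intro b c <;> simp_all [plift, tlift]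
  split <;> rfl

theorem psubst_plift_cancel (u : Pf) : ∀ k q, (u.plift 1 k).psubst k q = u := by
  induction u <;> intro k q <;> simp_all [plift, psubst]
  grind [psubst]

theorem tsubst_var_tlift (u : Pf) : ∀ k, (u.tlift 1 (k + 1)).tsubst k (.var k) = u := by
  induction u <;> intro k <;>
    simp_all [tlift, tsubst, Fml.subst_var_lift, Tm.subst_var_lift, Tm.lift_var]

end Pf

theorem transD_app_injLeft (A B : Fml) (u : Pf) :
    Relation.TransGen StepIL (.app (transD A B) (.qlam (.inj false u)))
      (.inj false (.qlam u)) := by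
  refine .head .beta (.head (.caseU .qbeta) (.head .caseInj ?_))
  simp only [Pf.psubst, Pf.tlift, Pf.plift, Pf.tlift_plift]
  refine .head (.injC (.qlamC (.caseU .qbeta))) (.single ?_)
  simp only [Pf.tsubst, Pf.psubst, Pf.psubst_plift_cancel, Pf.tsubst_var_tlift]
  exact .injC (.qlamC .caseInj)

theorem transD_app_injRight (A B : Fml) (u : Pf) :
    Relation.TransGen StepIL (.app (transD A B) (.qlam (.inj true u)))
      (.inj true (u.tsubst 0 (.const 0))) :=
  .head .beta (.head (.caseU .qbeta) (.single .caseInj))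

/-- **Preservation of the reduction relation**: for all proof terms `v`, `w`
of CD, if `v ↦ w` in CD then `v* ↦⁺ w*` in IL⊥, where `↦⁺` is the transitive
closure of the one-step reduction relation of IL⊥. -/
theorem trans_preserves_reduction {v w : Pf} (hv : v.IsCD)
    (h : StepCD v w) : Relation.TransGen StepIL (transPf v) (transPf w) := by
  clear hv
  induction h with
  | beta => rw [transPf_psubst]; exact .single .beta
  | qbeta => rw [transPf_tsubst]; exact .single .qbeta
  | projPair => rw [apply_ite transPf]; exact .single .projPair
  | caseInj => rw [transPf_psubst, apply_ite transPf]; exact .single .caseInj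
  | edestPair => rw [transPf_psubst, transPf_tsubst]; exact .single .edestPair
  | DinjL => exact transD_app_injLeft _ _ _
  | DinjR => simpa only [transPf, transPf_tsubst] using transD_app_injRight _ _ _
  | pairL _ ih => exact ih.lift (Pf.pair · _) fun _ _ => .pairL
  | pairR _ ih => exact ih.lift (Pf.pair _ ·) fun _ _ => .pairR
  | projC _ ih => exact ih.lift (Pf.proj _ ·) fun _ _ => .projC
  | lamC _ ih => exact ih.lift (Pf.lam _ ·) fun _ _ => .lamC
  | appL _ ih => exact ih.lift (Pf.app · _) fun _ _ => .appL
  | appR _ ih => exact ih.lift (Pf.app _ ·) fun _ _ => .appR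
  | injC _ ih => exact ih.lift (Pf.inj _ ·) fun _ _ => .injC
  | caseU _ ih => exact ih.lift (Pf.case · _ _) fun _ _ => .caseU
  | caseL _ ih => exact ih.lift (Pf.case _ · _) fun _ _ => .caseL
  | caseR _ ih => exact ih.lift (Pf.case _ _ ·) fun _ _ => .caseR
  | qlamC _ ih => exact ih.lift Pf.qlam fun _ _ => .qlamC
  | qappC _ ih => exact ih.lift (Pf.qapp · _) fun _ _ => .qappC
  | epairC _ ih => exact ih.lift (Pf.epair _ ·) fun _ _ => .epairC
  | edestL _ ih => exact ih.lift (Pf.edest · _) fun _ _ => .edestL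
  | edestR _ ih => exact ih.lift (Pf.edest _ ·) fun _ _ => .edestR
  | efqC _ ih => exact ih.lift (Pf.efq _ ·) fun _ _ => .efqC
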